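/- Let g : ℝⁿ → ℂ be smooth with compact support and let Q be a nondegenerate real symmetric n×n matrix. Then, as k → +∞, ∫_{ℝⁿ} g(x) e^{i k Q(x,x)} dx = g(0) · (π/k)^{n/2} · |det Q|^{-1/2} · e^{(iπ/4)·sign(Q)} + O(k^{-n/2-1}). -/

import Mathlib

open MeasureTheory Filter Asymptotics

noncomputable section

/-- The quadratic form `Q(x,x) = Σ_{i,j} Q_{ij} x_i x_j` of a real `n×n` matrix. -/
def quadForm (n : ℕ) (Q : Matrix (Fin n) (Fin n) ℝ) (x : Fin n → ℝ) : ℝ :=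
  ∑ i : Fin n, ∑ j : Fin n, Q i j * x i * x j

/-- The signature (number of positive eigenvalues minus the number of negative eigenvalues,
with multiplicity) of a real matrix `A`, computed via the symmetrization `A + Aᵀ`;
for a symmetric matrix `A` this is the usual signature of `A`. -/
def matrixSignature {n : ℕ} (A : Matrix (Fin n) (Fin n) ℝ) : ℤ :=
  ((Finset.univ.filter (fun i =>
      0 < (Matrix.isHermitian_add_transpose_self A).eigenvalues i)).card : ℤ) -
    ((Finset.univ.filter (fun i =>
      (Matrix.isHermitian_add_transpose_self A).eigenvalues i < 0)).card : ℤ)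

open scoped FourierTransform SchwartzMap Topology

section Gaussian

variable {ι : Type*} [Fintype ι]

theorem integrable_cexp_neg_sum_mul_sq_euclideanSpace {b : ι → ℂ} (hb : ∀ i, 0 < (b i).re) :
    Integrable (fun y : EuclideanSpace ℝ ι => Complex.exp (-∑ i, b i * (y i : ℂ) ^ 2)) := by
  rw [← (PiLp.volume_preserving_toLp ι).integrable_comp_emb
    (MeasurableEquiv.toLp 2 _).measurableEmbedding]
  simpa [Function.comp_def] using
    GaussianFourier.integrable_cexp_neg_sum_mul_add hb (fun _ => 0)

/-- The Fourier transform of an anisotropic complex Gaussian. -/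
theorem fourier_cexp_neg_sum_mul_sq {b : ι → ℂ} (hb : ∀ i, 0 < (b i).re)
    (ξ : EuclideanSpace ℝ ι) :
    𝓕 (fun y : EuclideanSpace ℝ ι => Complex.exp (-∑ i, b i * (y i : ℂ) ^ 2)) ξ =
      (∏ i, (Real.pi / b i) ^ (1 / 2 : ℂ)) *
        Complex.exp (-∑ i, (Real.pi : ℂ) ^ 2 / b i * (ξ i : ℂ) ^ 2) := by
  rw [Real.fourier_eq', ← (PiLp.volume_preserving_toLp ι).integral_comp
    (MeasurableEquiv.toLp 2 _).measurableEmbedding]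
  have h := GaussianFourier.integral_cexp_neg_sum_mul_add hb
    (fun i => -2 * Real.pi * Complex.I * ξ i)
  rw [Finset.prod_mul_distrib, ← Complex.exp_sum] at h
  convert h using 1
  · congr 1 with v
    rw [smul_eq_mul, ← Complex.exp_add, add_comm]
    congr 2
    simp only [PiLp.inner_apply, RCLike.inner_apply, conj_trivial]
    push_cast
    rw [Finset.mul_sum, Finset.sum_mul]
    exact Finset.sum_congr rfl fun i _ => by ring
  · congr 2
    rw [← Finset.sum_neg_distrib]
    refine Finset.sum_congr rfl fun i _ => ?_
    have hbi : b i ≠ 0 := fun h0 => by simpa [h0] using hb i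
    field_simp
    linear_combination (-4) * (ξ i : ℂ) ^ 2 * Complex.I_sq

theorem norm_cexp_neg_sum_mul_sq_le_one {b : ι → ℂ} (hb : ∀ i, 0 ≤ (b i).re) (y : ι → ℝ) :
    ‖Complex.exp (-∑ i, b i * (y i : ℂ) ^ 2)‖ ≤ 1 := by
  rw [Complex.norm_exp, Real.exp_le_one_iff, Complex.neg_re, Complex.re_sum, neg_nonpos]
  refine Finset.sum_nonneg fun i _ => ?_
  rw [← Complex.ofReal_pow, Complex.re_mul_ofReal]
  exact mul_nonneg (hb i) (sq_nonneg _)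

theorem integral_fourier_mul_cexp_neg_sum_of_re_pos (F : 𝓢(EuclideanSpace ℝ ι, ℂ))
    {b : ι → ℂ} (hb : ∀ i, 0 < (b i).re) :
    ∫ y, (𝓕 F) y * Complex.exp (-∑ i, b i * (y i : ℂ) ^ 2) =
      (∏ i, (Real.pi / b i) ^ (1 / 2 : ℂ)) *
        ∫ ξ, F ξ * Complex.exp (-∑ i, (Real.pi : ℂ) ^ 2 / b i * (ξ i : ℂ) ^ 2) := by
  have h := VectorFourier.integral_fourierIntegral_smul_eq_flip
    (L := innerₗ (EuclideanSpace ℝ ι)) Real.continuous_fourierChar continuous_inner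
    (F.integrable (μ := volume)) (integrable_cexp_neg_sum_mul_sq_euclideanSpace hb)
  have h' : ∫ y, (𝓕 F) y * Complex.exp (-∑ i, b i * (y i : ℂ) ^ 2) =
      ∫ ξ, F ξ * 𝓕 (fun y : EuclideanSpace ℝ ι =>
        Complex.exp (-∑ i, b i * (y i : ℂ) ^ 2)) ξ := by
    simpa using! h
  rw [h', ← integral_const_mul]
  refine integral_congr_ae (.of_forall fun ξ => ?_)
  simp only [fourier_cexp_neg_sum_mul_sq hb]
  ring

theorem tendsto_integral_mul_cexp_neg_sum {G : EuclideanSpace ℝ ι → ℂ} (hG : Integrable G)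
    {c : ℝ → ι → ℂ} {c₀ : ι → ℂ} (hc : ∀ᶠ ε in 𝓝[>] 0, ∀ i, 0 ≤ (c ε i).re)
    (hlim : ∀ i, Tendsto (fun ε => c ε i) (𝓝[>] 0) (𝓝 (c₀ i))) :
    Tendsto (fun ε => ∫ y, G y * Complex.exp (-∑ i, c ε i * (y i : ℂ) ^ 2)) (𝓝[>] 0)
      (𝓝 (∫ y, G y * Complex.exp (-∑ i, c₀ i * (y i : ℂ) ^ 2))) := by
  refine tendsto_integral_filter_of_dominated_convergence (fun y => ‖G y‖) ?_ ?_ hG.norm ?_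
  · refine .of_forall fun ε => hG.aestronglyMeasurable.mul ?_
    exact Continuous.aestronglyMeasurable (by fun_prop)
  · filter_upwards [hc] with ε hε
    refine .of_forall fun y => ?_
    rw [norm_mul]
    exact mul_le_of_le_one_right (norm_nonneg _) (norm_cexp_neg_sum_mul_sq_le_one hε _)
  · refine .of_forall fun y => tendsto_const_nhds.mul ?_
    refine (Complex.continuous_exp.tendsto _).comp (Tendsto.neg ?_)
    exact tendsto_finsetSum _ fun i _ => (hlim i).mul tendsto_const_nhds

theorem inv_re_nonneg {z : ℂ} (hz : 0 ≤ z.re) : 0 ≤ (z⁻¹).re := by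
  rw [Complex.inv_re]
  exact div_nonneg hz (Complex.normSq_nonneg z)

theorem div_mem_slitPlane_of_re_nonneg {r : ℝ} (hr : 0 < r) {z : ℂ} (hz : 0 ≤ z.re)
    (hz0 : z ≠ 0) : (r : ℂ) / z ∈ Complex.slitPlane := by
  rw [div_eq_mul_inv, Complex.mem_slitPlane_iff, Complex.re_ofReal_mul, Complex.im_ofReal_mul]
  rcases (inv_re_nonneg hz).lt_or_eq with h | h
  · exact .inl (mul_pos hr h)
  · refine .inr (mul_ne_zero hr.ne' fun h' => inv_ne_zero hz0 (Complex.ext h.symm h'))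

/-- Parseval's formula against a complex Gaussian, including purely oscillatory ones. -/
theorem integral_fourier_mul_cexp_neg_sum (F : 𝓢(EuclideanSpace ℝ ι, ℂ))
    {b : ι → ℂ} (hb : ∀ i, 0 ≤ (b i).re) (hb0 : ∀ i, b i ≠ 0) :
    ∫ y, (𝓕 F) y * Complex.exp (-∑ i, b i * (y i : ℂ) ^ 2) =
      (∏ i, (Real.pi / b i) ^ (1 / 2 : ℂ)) *
        ∫ ξ, F ξ * Complex.exp (-∑ i, (Real.pi : ℂ) ^ 2 / b i * (ξ i : ℂ) ^ 2) := by
  have hlim (i) : Tendsto (fun ε : ℝ => b i + ε) (𝓝[>] 0) (𝓝 (b i)) := by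
    have : Continuous fun ε : ℝ => b i + ε := by fun_prop
    simpa using (this.tendsto 0).mono_left nhdsWithin_le_nhds
  have hpos {ε : ℝ} (hε : 0 < ε) (i) : 0 < (b i + ε).re := by
    simpa using add_pos_of_nonneg_of_pos (hb i) hε
  have hL := tendsto_integral_mul_cexp_neg_sum (𝓕 F).integrable
    (c := fun ε i => b i + ε) (c₀ := b)
    (by filter_upwards [self_mem_nhdsWithin] with ε hε i using (hpos hε i).le) hlim
  have hR := tendsto_integral_mul_cexp_neg_sum F.integrable
    (c := fun ε i => (Real.pi : ℂ) ^ 2 / (b i + ε)) (c₀ := fun i => (Real.pi : ℂ) ^ 2 / b i)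
    (by
      filter_upwards [self_mem_nhdsWithin] with ε hε i
      rw [div_eq_mul_inv, ← Complex.ofReal_pow, Complex.re_ofReal_mul]
      exact mul_nonneg (sq_nonneg _) (inv_re_nonneg (hpos hε i).le))
    (fun i => tendsto_const_nhds.div (hlim i) (hb0 i))
  have hP : Tendsto (fun ε : ℝ => ∏ i, (Real.pi / (b i + ε)) ^ (1 / 2 : ℂ)) (𝓝[>] 0)
      (𝓝 (∏ i, (Real.pi / b i) ^ (1 / 2 : ℂ))) :=
    tendsto_finsetProd _ fun i _ => (tendsto_const_nhds.div (hlim i) (hb0 i)).cpow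
      tendsto_const_nhds (div_mem_slitPlane_of_re_nonneg Real.pi_pos (hb i) (hb0 i))
  refine tendsto_nhds_unique hL ((hP.mul hR).congr' ?_)
  filter_upwards [self_mem_nhdsWithin] with ε hε
  exact (integral_fourier_mul_cexp_neg_sum_of_re_pos F (hpos hε)).symm

/-- The principal square root of `π / (-i k t)`. -/
theorem cpow_half_pi_div_neg_I_mul {k t : ℝ} (hk : 0 < k) (ht : t ≠ 0) :
    ((Real.pi : ℂ) / (-(Complex.I * k * t))) ^ (1 / 2 : ℂ) =
      (((Real.pi / k) ^ (1 / 2 : ℝ) * |t| ^ (-(1 : ℝ) / 2) : ℝ) : ℂ) *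
        Complex.exp (Complex.I * Real.pi / 4 * (SignType.sign t : ℤ)) := by
  have hs : (SignType.sign t : ℤ) = 1 ∨ (SignType.sign t : ℤ) = -1 := by
    rcases ht.lt_or_gt with h | h <;> simp [h]
  have habs : t = |t| * ((SignType.sign t : ℤ) : ℝ) := by
    rcases ht.lt_or_gt with h | h <;> simp [h, abs_of_neg, abs_of_pos]
  have ht' : 0 < |t| := abs_pos.mpr ht
  generalize (SignType.sign t : ℤ) = s at *
  generalize |t| = a at *
  subst habs
  have hr : 0 < Real.pi / k * a⁻¹ := by positivity
  have hroot : (Real.pi / k) ^ (1 / 2 : ℝ) * a ^ (-(1 : ℝ) / 2) =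
      Real.exp (Real.log (Real.pi / k * a⁻¹) / 2) := by
    rw [neg_div, Real.rpow_neg ht'.le, ← Real.inv_rpow ht'.le,
      ← Real.mul_rpow (by positivity) (by positivity), Real.rpow_def_of_pos hr]
    congr 1
    ring
  have hI : Complex.exp (Real.pi / 2 * s * Complex.I) = Complex.I * s := by
    rcases hs with rfl | rfl
    · simp
    · simpa [neg_div] using Complex.exp_neg_pi_div_two_mul_I
  have hs2 : (s : ℂ) ^ 2 = 1 := by rcases hs with rfl | rfl <;> simp
  have hs0 : (s : ℂ) ≠ 0 := by rcases hs with rfl | rfl <;> simp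
  have hz : (Real.pi : ℂ) / (-(Complex.I * k * (a * s : ℝ))) =
      Complex.exp ((Real.log (Real.pi / k * a⁻¹) : ℝ) + (Real.pi / 2 * s : ℝ) * Complex.I) := by
    rw [Complex.exp_add, ← Complex.ofReal_exp, Real.exp_log hr]
    push_cast
    rw [hI]
    have : (k : ℂ) ≠ 0 := by exact_mod_cast hk.ne'
    have : (a : ℂ) ≠ 0 := by exact_mod_cast ht'.ne'
    field_simp
    rw [Complex.I_sq, hs2]
    ring
  have him : (((Real.log (Real.pi / k * a⁻¹) : ℝ) : ℂ) +
      (Real.pi / 2 * s : ℝ) * Complex.I).im = Real.pi / 2 * s := by simp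
  have hpi := Real.pi_pos
  rw [hz, Complex.cpow_def_of_ne_zero (Complex.exp_ne_zero _), Complex.log_exp, hroot,
    Complex.ofReal_exp, ← Complex.exp_add]
  · congr 1
    push_cast
    ring
  · rw [him]
    rcases hs with rfl | rfl <;> push_cast <;> linarith
  · rw [him]
    rcases hs with rfl | rfl <;> push_cast <;> linarith

theorem prod_cpow_half_pi_div_neg_I_mul {k : ℝ} (hk : 0 < k) {t : ι → ℝ} (ht : ∀ i, t i ≠ 0) :
    ∏ i, ((Real.pi : ℂ) / (-(Complex.I * k * t i))) ^ (1 / 2 : ℂ) =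
      (((Real.pi / k) ^ ((Fintype.card ι : ℝ) / 2) : ℝ) : ℂ) *
        ((|∏ i, t i| ^ (-(1 : ℝ) / 2) : ℝ) : ℂ) *
        Complex.exp (Complex.I * Real.pi / 4 * (∑ i, (SignType.sign (t i) : ℤ) : ℤ)) := by
  simp_rw [fun i => cpow_half_pi_div_neg_I_mul hk (ht i)]
  rw [Finset.prod_mul_distrib, ← Complex.exp_sum, ← Finset.mul_sum, ← Complex.ofReal_prod,
    Finset.prod_mul_distrib, Finset.prod_const, Finset.card_univ, ← Real.rpow_natCast,
    ← Real.rpow_mul (by positivity), Finset.abs_prod,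
    Real.finsetProd_rpow _ _ (fun i _ => abs_nonneg _)]
  push_cast
  rw [one_div_mul_eq_div]

theorem norm_integral_mul_cexp_sub_le (F : 𝓢(EuclideanSpace ℝ ι, ℂ)) (c : ι → ℝ) :
    ‖(∫ ξ, F ξ * Complex.exp (Complex.I * (∑ i, c i * ξ i ^ 2 : ℝ))) - ∫ ξ, F ξ‖ ≤
      (∑ i, |c i|) * ∫ ξ, ‖ξ‖ ^ 2 * ‖F ξ‖ := by
  have hint : Integrable fun ξ => F ξ * Complex.exp (Complex.I * (∑ i, c i * ξ i ^ 2 : ℝ)) := by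
    refine F.integrable.mul_bdd (c := 1) (Continuous.aestronglyMeasurable (by fun_prop))
      (.of_forall fun ξ => ?_)
    rw [mul_comm, Complex.norm_exp_ofReal_mul_I]
  rw [← integral_sub hint F.integrable, ← integral_const_mul]
  refine norm_integral_le_of_norm_le ((F.integrable_pow_mul volume 2).const_mul _)
    (.of_forall fun ξ => ?_)
  rw [← mul_sub_one, norm_mul, mul_comm, ← mul_assoc]
  gcongr
  refine Real.norm_exp_I_mul_ofReal_sub_one_le.trans ((norm_sum_le _ _).trans ?_)
  rw [Finset.sum_mul]
  gcongr with i
  rw [norm_mul, norm_pow, Real.norm_eq_abs]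
  gcongr
  exact PiLp.norm_apply_le ξ i

/-- Stationary phase for a diagonal quadratic phase and a Schwartz amplitude. -/
theorem isBigO_integral_mul_cexp_diagonal_sub (G : 𝓢(EuclideanSpace ℝ ι, ℂ)) {t : ι → ℝ}
    (ht : ∀ i, t i ≠ 0) :
    (fun k : ℝ => (∫ y, G y * Complex.exp (Complex.I * k * (∑ i, t i * y i ^ 2 : ℝ))) -
        G 0 * (((Real.pi / k) ^ ((Fintype.card ι : ℝ) / 2) : ℝ) : ℂ) *
          ((|∏ i, t i| ^ (-(1 : ℝ) / 2) : ℝ) : ℂ) *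
          Complex.exp (Complex.I * Real.pi / 4 * (∑ i, (SignType.sign (t i) : ℤ) : ℤ)))
      =O[atTop] fun k : ℝ => k ^ (-(Fintype.card ι : ℝ) / 2 - 1) := by
  obtain ⟨F, rfl⟩ : ∃ F, G = 𝓕 F := ⟨𝓕⁻ G, (FourierTransform.fourier_fourierInv_eq G).symm⟩
  have hF0 : (𝓕 F) 0 = ∫ ξ, F ξ := by simp [SchwartzMap.fourier_coe, Real.fourier_eq']
  set A : ℝ := (∑ i, |Real.pi ^ 2 / t i|) * ∫ ξ, ‖ξ‖ ^ 2 * ‖F ξ‖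
  set d : ℝ := |∏ i, t i| ^ (-(1 : ℝ) / 2)
  refine IsBigO.of_bound (Real.pi ^ ((Fintype.card ι : ℝ) / 2) * d * A) ?_
  filter_upwards [eventually_gt_atTop 0] with k hk
  have hparseval := integral_fourier_mul_cexp_neg_sum F (b := fun i => -(Complex.I * k * t i))
    (fun i => by simp) (fun i => by simp [ht i, hk.ne'])
  have hL (y : EuclideanSpace ℝ ι) : -∑ i, -(Complex.I * k * t i) * (y i : ℂ) ^ 2 =
      Complex.I * k * (∑ i, t i * y i ^ 2 : ℝ) := by
    push_cast
    rw [Finset.mul_sum, ← Finset.sum_neg_distrib]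
    exact Finset.sum_congr rfl fun i _ => by ring
  have hR (ξ : EuclideanSpace ℝ ι) :
      -∑ i, (Real.pi : ℂ) ^ 2 / (-(Complex.I * k * t i)) * (ξ i : ℂ) ^ 2 =
      Complex.I * (∑ i, -(Real.pi ^ 2 / t i) / k * ξ i ^ 2 : ℝ) := by
    push_cast
    rw [Finset.mul_sum, ← Finset.sum_neg_distrib]
    refine Finset.sum_congr rfl fun i _ => ?_
    have : (k : ℂ) ≠ 0 := by exact_mod_cast hk.ne'
    have : (t i : ℂ) ≠ 0 := by exact_mod_cast ht i
    field_simp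
    rw [Complex.I_sq]
    ring
  simp only [hL, hR, prod_cpow_half_pi_div_neg_I_mul hk ht] at hparseval
  rw [hparseval, hF0]
  have hbound := norm_integral_mul_cexp_sub_le F fun i => -(Real.pi ^ 2 / t i) / k
  have hsum : ∑ i, |-(Real.pi ^ 2 / t i) / k| = (∑ i, |Real.pi ^ 2 / t i|) / k := by
    simp_rw [abs_div _ k, abs_neg, abs_of_pos hk, Finset.sum_div]
  rw [hsum, div_mul_eq_mul_div] at hbound
  have hunit (m : ℤ) : ‖Complex.exp (Complex.I * Real.pi / 4 * m)‖ = 1 := by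
    have := Complex.norm_exp_ofReal_mul_I (Real.pi / 4 * m)
    rw [← this]
    congr 2
    push_cast
    ring
  rw [mul_assoc (∫ ξ, F ξ), mul_assoc (∫ ξ, F ξ), mul_comm (∫ ξ, F ξ), ← mul_assoc, ← mul_sub,
    norm_mul, norm_mul, norm_mul, hunit, Complex.norm_real, Complex.norm_real, mul_one,
    Real.norm_of_nonneg (by positivity), Real.norm_of_nonneg (by positivity),
    Real.norm_of_nonneg (by positivity)]
  calc _ ≤ (Real.pi / k) ^ ((Fintype.card ι : ℝ) / 2) * d * (A / k) := by gcongr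
    _ = _ := by
      rw [Real.div_rpow Real.pi_pos.le hk.le, Real.rpow_sub_one hk.ne', neg_div,
        Real.rpow_neg hk.le]
      ring

end Gaussian

section Diagonalization

open scoped Matrix

theorem quadForm_eq_dotProduct (n : ℕ) (Q : Matrix (Fin n) (Fin n) ℝ) (x : Fin n → ℝ) :
    quadForm n Q x = x ⬝ᵥ Q *ᵥ x := by
  simp only [quadForm, dotProduct, Matrix.mulVec, Finset.mul_sum]
  exact Finset.sum_congr rfl fun i _ => Finset.sum_congr rfl fun j _ => by ring

theorem dotProduct_mulVec_eigenvectorBasis_repr_symm {m : Type*} [Fintype m] [DecidableEq m]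
    {A : Matrix m m ℝ} (hA : A.IsHermitian) (y : EuclideanSpace ℝ m) :
    (hA.eigenvectorBasis.repr.symm y).ofLp ⬝ᵥ A *ᵥ (hA.eigenvectorBasis.repr.symm y).ofLp =
      ∑ i, hA.eigenvalues i * y i ^ 2 := by
  set x := hA.eigenvectorBasis.repr.symm y with hx
  have hAx : WithLp.toLp 2 (A *ᵥ x.ofLp) =
      hA.eigenvectorBasis.repr.symm (WithLp.toLp 2 fun i => hA.eigenvalues i * y i) := by
    have key := hA.mulVec_eigenvectorBasis
    rw [hx, ← OrthonormalBasis.sum_repr_symm, ← OrthonormalBasis.sum_repr_symm]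
    ext j
    simp only [WithLp.ofLp_sum, WithLp.ofLp_smul, Matrix.mulVec_sum, Matrix.mulVec_smul, key,
      Finset.sum_apply, Pi.smul_apply, smul_eq_mul]
    exact Finset.sum_congr rfl fun i _ => by ring
  have h : x.ofLp ⬝ᵥ A *ᵥ x.ofLp = inner ℝ (WithLp.toLp 2 (A *ᵥ x.ofLp)) x := by
    simp [PiLp.inner_apply, dotProduct]
  rw [h, hAx, hx, LinearIsometryEquiv.inner_map_map]
  simp only [PiLp.inner_apply, RCLike.inner_apply, conj_trivial]
  exact Finset.sum_congr rfl fun i _ => by ring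

theorem quadForm_eigenvectorBasis_repr_symm {n : ℕ} {Q : Matrix (Fin n) (Fin n) ℝ}
    (hQ : Q.IsSymm) (y : EuclideanSpace ℝ (Fin n)) :
    quadForm n Q
        ((Matrix.isHermitian_add_transpose_self Q).eigenvectorBasis.repr.symm y).ofLp =
      ∑ i, (Matrix.isHermitian_add_transpose_self Q).eigenvalues i / 2 * y i ^ 2 := by
  have h := dotProduct_mulVec_eigenvectorBasis_repr_symm
    (Matrix.isHermitian_add_transpose_self Q) y
  generalize (Matrix.isHermitian_add_transpose_self Q).eigenvectorBasis.repr.symm y = x at h ⊢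
  have h2 : x.ofLp ⬝ᵥ (Q + Qᴴ) *ᵥ x.ofLp = 2 * quadForm n Q x.ofLp := by
    rw [Matrix.conjTranspose_eq_transpose_of_trivial, hQ.eq, Matrix.add_mulVec, dotProduct_add,
      ← quadForm_eq_dotProduct, two_mul]
  rw [h2] at h
  simp_rw [div_mul_eq_mul_div, ← Finset.sum_div, ← h]
  ring

theorem prod_half_eigenvalues_add_transpose {n : ℕ} {Q : Matrix (Fin n) (Fin n) ℝ}
    (hQ : Q.IsSymm) :
    ∏ i, (Matrix.isHermitian_add_transpose_self Q).eigenvalues i / 2 = Q.det := by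
  have h := (Matrix.isHermitian_add_transpose_self Q).det_eq_prod_eigenvalues
  have h2 : (Q + Qᴴ).det = 2 ^ n * Q.det := by
    rw [Matrix.conjTranspose_eq_transpose_of_trivial, hQ.eq, ← two_smul ℝ Q, Matrix.det_smul,
      Fintype.card_fin]
  rw [h2] at h
  rw [Finset.prod_div_distrib, Finset.prod_const, Finset.card_univ, Fintype.card_fin,
    div_eq_iff (by positivity), mul_comm, h]
  rfl

theorem matrixSignature_eq_sum_sign {n : ℕ} (Q : Matrix (Fin n) (Fin n) ℝ) :
    matrixSignature Q = ∑ i, (SignType.sign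
      ((Matrix.isHermitian_add_transpose_self Q).eigenvalues i / 2) : ℤ) := by
  rw [matrixSignature, Finset.card_filter, Finset.card_filter]
  push_cast
  rw [← Finset.sum_sub_distrib]
  refine Finset.sum_congr rfl fun i _ => ?_
  generalize (Matrix.isHermitian_add_transpose_self Q).eigenvalues i = a
  rcases lt_trichotomy a 0 with h | h | h
  · simp [h, h.not_gt, sign_neg (div_neg_of_neg_of_pos h two_pos)]
  · simp [h]
  · simp [h, h.not_gt]

end Diagonalization

/-- **Leading-order stationary phase with quadratic phase**: for `g` smooth compactly
supported and `Q` nondegenerate symmetric,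
`∫ g(x) e^{ikQ(x,x)} dx = g(0) (π/k)^{n/2} |det Q|^{-1/2} e^{(iπ/4) sign Q}
+ O(k^{-n/2-1})` as `k → +∞`. -/
theorem quadratic_stationary_phase
    (n : ℕ) (g : (Fin n → ℝ) → ℂ) (hg : ContDiff ℝ (⊤ : ℕ∞) g)
    (hgsupp : HasCompactSupport g)
    (Q : Matrix (Fin n) (Fin n) ℝ) (hQsymm : Q.IsSymm) (hQdet : Q.det ≠ 0) :
    (fun k : ℝ =>
        (∫ x : Fin n → ℝ, g x * Complex.exp (Complex.I * (k : ℂ) * (quadForm n Q x : ℂ))) -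
          g 0 * (((Real.pi / k) ^ ((n : ℝ) / 2) : ℝ) : ℂ) *
            ((|Q.det| ^ (-(1 : ℝ) / 2) : ℝ) : ℂ) *
            Complex.exp (Complex.I * (Real.pi : ℂ) / 4 * (matrixSignature Q : ℂ)))
      =O[atTop] fun k : ℝ => k ^ (-(n : ℝ) / 2 - 1) := by
  let b := (Matrix.isHermitian_add_transpose_self Q).eigenvectorBasis
  have hprod := prod_half_eigenvalues_add_transpose hQsymm
  have hne (i) : (Matrix.isHermitian_add_transpose_self Q).eigenvalues i / 2 ≠ 0 := fun h =>
    hQdet (hprod ▸ Finset.prod_eq_zero (Finset.mem_univ i) h)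
  let e : EuclideanSpace ℝ (Fin n) ≃L[ℝ] (Fin n → ℝ) :=
    b.repr.symm.toContinuousLinearEquiv.trans (EuclideanSpace.equiv (Fin n) ℝ)
  have he : MeasurePreserving e :=
    (PiLp.volume_preserving_ofLp (Fin n)).comp b.measurePreserving_repr_symm
  let G : 𝓢(EuclideanSpace ℝ (Fin n), ℂ) :=
    (hgsupp.comp_homeomorph e.toHomeomorph).toSchwartzMap (hg.comp e.contDiff)
  have hG (y) : G y = g (e y) := rfl
  have h := isBigO_integral_mul_cexp_diagonal_sub G hne
  rw [hprod, ← matrixSignature_eq_sum_sign, Fintype.card_fin, hG, map_zero] at h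
  convert h using 3 with k
  rw [← he.integral_comp e.toHomeomorph.measurableEmbedding]
  refine integral_congr_ae (.of_forall fun y => ?_)
  simp only [hG, ← quadForm_eigenvectorBasis_repr_symm hQsymm]
  rfl
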